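/- One-step Lyapunov contraction for SAGA with Lipschitz sampling and uniform memory update (key inequality in the proof of Proposition 1(b)): Let E be a real inner product space, let n ≥ 1, and let f_1, …, f_n : E → ℝ be convex and differentiable with ∇f_i Lipschitz continuous with constant L_i > 0. Suppose f = (1/n)∑_{i=1}^n f_i is μ-strongly convex with 0 < μ ≤ L̄, where L̄ = (1/n)∑_i L_i, and let x* be the minimizer of f. Set the step size γ = 1/(4L̄), c = 1/(2γ(1 − γμ)n), and 1/κ = min{1/(3n), μ/(8L̄)}. Define, for x ∈ E and φ : {1,…,n} → E, T(x, φ) = (1/n)∑_{i=1}^n f_i(φ_i) − f(x*) − (1/n)∑_{i=1}^n ⟨∇f_i(x*), φ_i − x*⟩ + c‖x − x*‖². For a sampled index j (with probability L_j/(nL̄)) and an independent uniformly sampled index r, define ν_j = (L̄/L_j)(∇f_j(x) − ∇f_j(φ_j)) + (1/n)∑_{i=1}^n ∇f_i(φ_i), x⁺_j = x − γ ν_j, and φ⁺(r) to agree with φ except that its r-th entry is replaced by x. Then ∑_{j=1}^n ∑_{r=1}^n (L_j/(nL̄))·(1/n)·T(x⁺_j, φ⁺(r)) ≤ (1 − 1/κ)·T(x,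 φ). -/

import Mathlib

open scoped BigOperators RealInnerProductSpace

section FirstOrder

variable {E : Type*} [NormedAddCommGroup E] [InnerProductSpace ℝ E]

theorem HasFDerivAt.hasDerivAt_line {g : E → ℝ} {g' : E →L[ℝ] ℝ} {x d : E} {t : ℝ}
    (hg : HasFDerivAt g g' (x + t • d)) :
    HasDerivAt (fun s : ℝ => g (x + s • d)) (g' d) t := by
  have hline : HasDerivAt (fun s : ℝ => x + s • d) d t := by
    simpa using ((hasDerivAt_id t).smul_const d).const_add x
  exact hg.comp_hasDerivAt t hline

theorem ConvexOn.add_fderiv_sub_le {g : E → ℝ} {g' : E →L[ℝ] ℝ} {x : E}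
    (hconv : ConvexOn ℝ Set.univ g) (hg : HasFDerivAt g g' x) (y : E) :
    g x + g' (y - x) ≤ g y := by
  have hline : HasDerivAt (fun s : ℝ => g (x + s • (y - x))) (g' (y - x)) 0 :=
    HasFDerivAt.hasDerivAt_line (by simpa using hg)
  have hcv : ConvexOn ℝ Set.univ (fun s : ℝ => g (x + s • (y - x))) := by
    have h := hconv.comp_affineMap (AffineMap.lineMap x y)
    simpa [Function.comp_def, AffineMap.lineMap_apply, add_comm] using h
  have h := hcv.le_slope_of_hasDerivAt (Set.mem_univ 0) (Set.mem_univ 1) one_pos hline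
  simp [slope_def_field] at h
  rw [map_sub]
  linarith

variable [CompleteSpace E]

theorem ConvexOn.add_inner_gradient_le {g : E → ℝ} (hconv : ConvexOn ℝ Set.univ g)
    (hg : Differentiable ℝ g) (x y : E) :
    g x + ⟪gradient g x, y - x⟫ ≤ g y := by
  simpa using hconv.add_fderiv_sub_le (hg x).hasGradientAt.hasFDerivAt y

/-- The descent lemma. -/
theorem le_add_inner_gradient_add_of_lipschitz_gradient {g : E → ℝ} {L : ℝ}
    (hg : Differentiable ℝ g)
    (hlip : ∀ w v : E, ‖gradient g w - gradient g v‖ ≤ L * ‖w - v‖) (y z : E) :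
    g z ≤ g y + ⟪gradient g y, z - y⟫ + L / 2 * ‖z - y‖ ^ 2 := by
  set d := z - y with hd
  set q : ℝ → ℝ := fun t => g (y + t • d) - t * ⟪gradient g y, d⟫ - t ^ 2 * (L / 2 * ‖d‖ ^ 2)
    with hq
  have hderiv (t : ℝ) : HasDerivAt q
      (⟪gradient g (y + t • d), d⟫ - ⟪gradient g y, d⟫ - 2 * t * (L / 2 * ‖d‖ ^ 2)) t := by
    have h₁ : HasDerivAt (fun s : ℝ => g (y + s • d)) ⟪gradient g (y + t • d), d⟫ t := by
      simpa using (hg (y + t • d)).hasGradientAt.hasFDerivAt.hasDerivAt_line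
    have h₂ := (hasDerivAt_id t).mul_const ⟪gradient g y, d⟫
    have h₃ := (hasDerivAt_pow 2 t).mul_const (L / 2 * ‖d‖ ^ 2)
    simpa [hq] using (h₁.fun_sub h₂).fun_sub h₃
  have hanti : AntitoneOn q (Set.Icc 0 1) := by
    refine antitoneOn_of_deriv_nonpos (convex_Icc 0 1)
      (fun t _ => (hderiv t).continuousAt.continuousWithinAt)
      (fun t _ => (hderiv t).differentiableAt.differentiableWithinAt) fun t ht => ?_
    rw [interior_Icc] at ht
    rw [(hderiv t).deriv, ← inner_sub_left]
    have h₁ := real_inner_le_norm (gradient g (y + t • d) - gradient g y) d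
    have h₂ := hlip (y + t • d) y
    rw [add_sub_cancel_left, norm_smul, Real.norm_of_nonneg ht.1.le] at h₂
    have h₃ := mul_le_mul_of_nonneg_right h₂ (norm_nonneg d)
    linarith
  have h := hanti (Set.left_mem_Icc.2 zero_le_one) (Set.right_mem_Icc.2 zero_le_one) zero_le_one
  simp only [hq, one_smul, zero_smul, add_zero, hd, add_sub_cancel] at h
  rw [← hd] at h
  linarith

/-- The cocoercivity-type lower bound for convex functions with Lipschitz gradient. -/
theorem ConvexOn.add_inner_gradient_add_sq_le {g : E → ℝ} {L : ℝ} (hL : 0 < L)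
    (hconv : ConvexOn ℝ Set.univ g) (hg : Differentiable ℝ g)
    (hlip : ∀ w v : E, ‖gradient g w - gradient g v‖ ≤ L * ‖w - v‖) (x y : E) :
    g x + ⟪gradient g x, y - x⟫ + 1 / (2 * L) * ‖gradient g y - gradient g x‖ ^ 2 ≤ g y := by
  set e := gradient g y - gradient g x with he
  have h₁ := le_add_inner_gradient_add_of_lipschitz_gradient hg hlip y (y - (1 / L) • e)
  have h₂ := hconv.add_inner_gradient_le hg x (y - (1 / L) • e)
  have h₃ : ⟪gradient g y, e⟫ - ⟪gradient g x, e⟫ = ‖e‖ ^ 2 := by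
    rw [← inner_sub_left, ← he, real_inner_self_eq_norm_sq]
  rw [sub_sub_cancel_left, norm_neg, norm_smul, inner_neg_right, inner_smul_right,
    Real.norm_of_nonneg (by positivity)] at h₁
  rw [sub_right_comm, inner_sub_right, inner_smul_right] at h₂
  have h₄ : L / 2 * (1 / L * ‖e‖) ^ 2 = 1 / (2 * L) * ‖e‖ ^ 2 := by field_simp
  have h₅ : 1 / L * ‖e‖ ^ 2 = 2 * (1 / (2 * L) * ‖e‖ ^ 2) := by field_simp
  have h₆ : 1 / L * ⟪gradient g y, e⟫ - 1 / L * ⟪gradient g x, e⟫ = 1 / L * ‖e‖ ^ 2 := by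
    rw [← mul_sub, h₃]
  linarith

/-- First-order lower bound for a strongly convex function. -/
theorem add_fderiv_sub_add_sq_le_of_strongly_convex {g : E → ℝ} {μ : ℝ} {g' x : E}
    (hsc : ConvexOn ℝ Set.univ (fun w => g w - μ / 2 * ‖w‖ ^ 2)) (hg : HasGradientAt g g' x)
    (y : E) : g x + ⟪g', y - x⟫ + μ / 2 * ‖y - x‖ ^ 2 ≤ g y := by
  have hn : HasFDerivAt (fun w : E => μ / 2 * ‖w‖ ^ 2) _ x :=
    ((hasStrictFDerivAt_norm_sq x).hasFDerivAt).const_mul (μ / 2)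
  have h := hsc.add_fderiv_sub_le (hg.hasFDerivAt.sub hn) y
  have hy : ‖y‖ ^ 2 = ‖x‖ ^ 2 + 2 * ⟪x, y - x⟫ + ‖y - x‖ ^ 2 := by
    rw [← norm_add_sq_real, add_sub_cancel]
  simp at h
  rw [hy] at h
  linarith

end FirstOrder

section WeightedSums

variable {E ι : Type*} [NormedAddCommGroup E] [InnerProductSpace ℝ E] [Fintype ι]

theorem sum_mul_norm_sub_smul_sq (p : ι → ℝ) (hp : ∑ j, p j = 1) (y : E) (γ : ℝ) (v : ι → E) :
    ∑ j, p j * ‖y - γ • v j‖ ^ 2 =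
      ‖y‖ ^ 2 - 2 * γ * ⟪∑ j, p j • v j, y⟫ + γ ^ 2 * ∑ j, p j * ‖v j‖ ^ 2 := by
  have h (j : ι) : p j * ‖y - γ • v j‖ ^ 2 =
      p j * ‖y‖ ^ 2 - 2 * γ * (p j * ⟪v j, y⟫) + γ ^ 2 * (p j * ‖v j‖ ^ 2) := by
    rw [norm_sub_sq_real, inner_smul_right, norm_smul, mul_pow, Real.norm_eq_abs, sq_abs,
      real_inner_comm]
    ring
  simp_rw [h, sum_inner, real_inner_smul_left]
  rw [Finset.sum_add_distrib, Finset.sum_sub_distrib, ← Finset.sum_mul, hp, Finset.mul_sum,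
    Finset.mul_sum, one_mul]

theorem sum_mul_norm_sub_mean_sq_le (p : ι → ℝ) (hp : ∑ j, p j = 1) (w : ι → E) :
    ∑ j, p j * ‖w j - ∑ i, p i • w i‖ ^ 2 ≤ ∑ j, p j * ‖w j‖ ^ 2 := by
  have h := sum_mul_norm_sub_smul_sq p hp (∑ i, p i • w i) 1 w
  simp_rw [one_smul, norm_sub_rev, real_inner_self_eq_norm_sq] at h
  rw [h]
  nlinarith [sq_nonneg ‖∑ i, p i • w i‖]

theorem sum_mul_norm_sub_sub_mean_sq_le (p : ι → ℝ) (hp₀ : ∀ j, 0 ≤ p j) (hp : ∑ j, p j = 1)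
    (u w : ι → E) :
    ∑ j, p j * ‖u j - (w j - ∑ i, p i • w i)‖ ^ 2 ≤
      2 * ∑ j, p j * ‖u j‖ ^ 2 + 2 * ∑ j, p j * ‖w j‖ ^ 2 := by
  have h (j : ι) : p j * ‖u j - (w j - ∑ i, p i • w i)‖ ^ 2 ≤
      2 * (p j * ‖u j‖ ^ 2) + 2 * (p j * ‖w j - ∑ i, p i • w i‖ ^ 2) := by
    have h₁ := parallelogram_law_with_norm ℝ (u j) (w j - ∑ i, p i • w i)
    have h₂ : ‖u j - (w j - ∑ i, p i • w i)‖ ^ 2 ≤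
        2 * ‖u j‖ ^ 2 + 2 * ‖w j - ∑ i, p i • w i‖ ^ 2 := by
      nlinarith [sq_nonneg ‖u j + (w j - ∑ i, p i • w i)‖]
    nlinarith [mul_le_mul_of_nonneg_left h₂ (hp₀ j)]
  calc _ ≤ ∑ j, (2 * (p j * ‖u j‖ ^ 2) + 2 * (p j * ‖w j - ∑ i, p i • w i‖ ^ 2)) :=
        Finset.sum_le_sum fun j _ => h j
    _ = 2 * ∑ j, p j * ‖u j‖ ^ 2 + 2 * ∑ j, p j * ‖w j - ∑ i, p i • w i‖ ^ 2 := by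
        rw [Finset.sum_add_distrib, Finset.mul_sum, Finset.mul_sum]
    _ ≤ _ := by linarith [sum_mul_norm_sub_mean_sq_le p hp w]

theorem sum_sum_update {α : Type*} [DecidableEq ι] (h : ι → α → ℝ) (φ : ι → α) (x : α) :
    ∑ r, ∑ i, h i (Function.update φ r x i) =
      (Fintype.card ι - 1) * ∑ i, h i (φ i) + ∑ i, h i x := by
  have hr (r : ι) : ∑ i, h i (Function.update φ r x i) =
      ∑ i, h i (φ i) - h r (φ r) + h r x := by
    rw [← Finset.add_sum_erase _ _ (Finset.mem_univ r),
      ← Finset.add_sum_erase _ (fun i => h i (φ i)) (Finset.mem_univ r),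
      Finset.sum_congr rfl fun i hi => by
        rw [Function.update_of_ne (Finset.ne_of_mem_erase hi)]]
    simp
    ring
  simp_rw [hr]
  rw [Finset.sum_add_distrib, Finset.sum_sub_distrib, Finset.sum_const, Finset.card_univ,
    nsmul_eq_mul]
  ring

end WeightedSums

/-- The arithmetic behind the Lyapunov contraction, with `L` the mean Lipschitz constant, `δ` the
suboptimality gap, `R` the squared distance to the minimizer, `D` the memory term of the Lyapunov
function, and `S` the expected squared distance after one step. -/
theorem saga_contraction_of_moment_bounds {n L μ γ c invκ δ R D A B P S : ℝ} (hn : 0 < n)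
    (hμ : 0 < μ) (hμL : μ ≤ L) (hγ : γ = 1 / (4 * L)) (hc : c = 1 / (2 * γ * (1 - γ * μ) * n))
    (hκ : invκ = min (1 / (3 * n)) (μ / (8 * L))) (hδ : 0 ≤ δ) (hR : 0 ≤ R) (hD : 0 ≤ D)
    (hBD : B ≤ 2 * D) (hP₁ : δ + μ / 2 * R ≤ P) (hP₂ : δ + A / 2 ≤ P)
    (hS : S ≤ R - 2 * γ * P + γ ^ 2 * (2 * (L * A) + 2 * (L * B))) :
    (1 - 1 / n) * D + 1 / n * δ + c * S ≤ (1 - invκ) * (D + c * R) := by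
  have hL : 0 < L := hμ.trans_le hμL
  have hγ0 : 0 < γ := by rw [hγ]; positivity
  have hγL : γ * L = 1 / 4 := by rw [hγ]; field_simp
  have hγμ : γ * μ ≤ 1 / 4 := hγL ▸ mul_le_mul_of_nonneg_left hμL hγ0.le
  have hγμ0 : 0 < γ * μ := mul_pos hγ0 hμ
  have h1γμ : 0 < 1 - γ * μ := by linarith
  have hc0 : 0 < c := by rw [hc]; positivity
  have hcγ0 : 0 < c * γ := mul_pos hc0 hγ0
  have hcγ : c * γ * (1 - γ * μ) = 1 / n / 2 := by rw [hc]; field_simp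
  have hcγ_lower : 1 / n ≤ 2 * (c * γ) := by linarith [mul_pos hcγ0 hγμ0]
  have hcγ_upper : c * γ ≤ 2 / 3 * (1 / n) := by
    linarith [mul_le_mul_of_nonneg_left hγμ hcγ0.le]
  have hκ₁ : invκ ≤ 1 / 3 * (1 / n) := by
    rw [hκ]
    exact (min_le_left _ _).trans_eq (by field_simp)
  have hκ₂ : invκ ≤ γ * μ / 2 := by
    rw [hκ]
    exact (min_le_right _ _).trans_eq (by rw [hγ]; field_simp; norm_num)
  have hstep : S ≤ (1 - γ * μ / 2) * R - 2 * γ * δ + γ * D := by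
    have h₁ : γ ^ 2 * (2 * (L * A) + 2 * (L * B)) = γ * ((A + B) / 2) := by
      linear_combination (2 * γ * (A + B)) * hγL
    rw [h₁] at hS
    have h₂ : δ + μ / 4 * R + A / 4 ≤ P := by linarith
    linarith [mul_le_mul_of_nonneg_left h₂ hγ0.le, mul_le_mul_of_nonneg_left hBD hγ0.le]
  have e₁ := mul_le_mul_of_nonneg_left hstep hc0.le
  have e₂ := mul_le_mul_of_nonneg_right hcγ_lower hδ
  have e₃ := mul_le_mul_of_nonneg_right (add_le_add hcγ_upper hκ₁) hD
  have e₄ := mul_le_mul_of_nonneg_right hκ₂ (mul_nonneg hc0.le hR)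
  linarith

/-- One-step Lyapunov contraction for SAGA with Lipschitz sampling and uniform
memory update (key inequality in the proof of Proposition 1(b)). -/
theorem saga_lipschitz_sampling_one_step_contraction
    {E : Type*} [NormedAddCommGroup E] [InnerProductSpace ℝ E] [CompleteSpace E]
    {n : ℕ} (hn : 1 ≤ n)
    (f : Fin n → E → ℝ) (Lc : Fin n → ℝ) (hL : ∀ i, 0 < Lc i)
    (hconv : ∀ i, ConvexOn ℝ Set.univ (f i))
    (hdiff : ∀ i, Differentiable ℝ (f i))
    (hlip : ∀ i, ∀ w v : E, ‖gradient (f i) w - gradient (f i) v‖ ≤ Lc i * ‖w - v‖)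
    (Lbar : ℝ) (hLbar : Lbar = (1 / n : ℝ) * ∑ i, Lc i)
    (fbar : E → ℝ) (hfbar : fbar = fun w => (1 / n : ℝ) * ∑ i, f i w)
    (μ : ℝ) (hμ : 0 < μ) (hμL : μ ≤ Lbar)
    (hsc : ConvexOn ℝ Set.univ (fun w => fbar w - μ / 2 * ‖w‖ ^ 2))
    (xstar : E) (hmin : ∀ w, fbar xstar ≤ fbar w)
    (γ : ℝ) (hγ : γ = 1 / (4 * Lbar))
    (c : ℝ) (hc : c = 1 / (2 * γ * (1 - γ * μ) * n))
    (invκ : ℝ) (hκ : invκ = min (1 / (3 * (n : ℝ))) (μ / (8 * Lbar)))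
    (T : E → (Fin n → E) → ℝ)
    (hT : ∀ z ψ, T z ψ =
      (1 / n : ℝ) * ∑ i, f i (ψ i) - fbar xstar
        - (1 / n : ℝ) * ∑ i, ⟪gradient (f i) xstar, ψ i - xstar⟫
        + c * ‖z - xstar‖ ^ 2)
    (x : E) (φ : Fin n → E)
    (ν : Fin n → E)
    (hν : ∀ j, ν j = (Lbar / Lc j) • (gradient (f j) x - gradient (f j) (φ j))
        + (1 / n : ℝ) • ∑ i, gradient (f i) (φ i))
    (xplus : Fin n → E) (hxplus : ∀ j, xplus j = x - γ • ν j)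
    (φplus : Fin n → Fin n → E) (hφplus : ∀ r, φplus r = Function.update φ r x) :
    ∑ j, ∑ r, (Lc j / (n * Lbar)) * (1 / n : ℝ) * T (xplus j) (φplus r) ≤
      (1 - invκ) * T x φ := by
  have hn0 : (0 : ℝ) < n := by exact_mod_cast hn
  have hLb : 0 < Lbar := hμ.trans_le hμL
  have hsumL : ∑ i, Lc i = n * Lbar := by rw [hLbar]; field_simp
  set g : Fin n → E → E := fun i => gradient (f i) with hg
  set p : Fin n → ℝ := fun j => Lc j / (n * Lbar) with hp
  have hp0 (j : Fin n) : 0 ≤ p j := by have := hL j; simp only [hp]; positivity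
  have hp1 : ∑ j, p j = 1 := by
    simp only [hp]
    rw [← Finset.sum_div, hsumL, div_self (by positivity)]
  have hgrad (w : E) : HasGradientAt fbar ((1 / n : ℝ) • ∑ i, g i w) w := by
    rw [hasGradientAt_iff_hasFDerivAt, hfbar, map_smul, map_sum]
    exact (HasFDerivAt.fun_sum fun i _ => (hdiff i w).hasGradientAt.hasFDerivAt).const_mul _
  have hgrad0 : ∑ i, g i xstar = 0 := by
    have h : IsLocalMin fbar xstar := Filter.Eventually.of_forall hmin
    have h' := h.hasFDerivAt_eq_zero (hgrad xstar).hasFDerivAt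
    have h'' : (1 / n : ℝ) • ∑ i, g i xstar = 0 := by
      simpa only [map_eq_zero_iff _ (InnerProductSpace.toDual ℝ E).injective] using h'
    exact (smul_eq_zero.1 h'').resolve_left (by positivity)
  -- The Bregman divergences at the minimizer.
  set B : Fin n → E → ℝ :=
    fun i y => f i y - f i xstar - ⟪g i xstar, y - xstar⟫ with hB
  set H : (Fin n → E) → ℝ :=
    fun ψ => (1 / n : ℝ) * ∑ i, 1 / Lc i * ‖g i (ψ i) - g i xstar‖ ^ 2 with hH
  set D : (Fin n → E) → ℝ := fun ψ => (1 / n : ℝ) * ∑ i, B i (ψ i) with hD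
  have hBle (i : Fin n) (y : E) : 1 / Lc i * ‖g i y - g i xstar‖ ^ 2 ≤ 2 * B i y := by
    have h := (hconv i).add_inner_gradient_add_sq_le (hL i) (hdiff i) (hlip i) xstar y
    have h' : 1 / Lc i * ‖g i y - g i xstar‖ ^ 2 =
        2 * (1 / (2 * Lc i) * ‖g i y - g i xstar‖ ^ 2) := by
      have := (hL i).ne'
      field_simp
    simp only [hB]
    simp only [hg] at *
    linarith
  have hHD (ψ : Fin n → E) : H ψ ≤ 2 * D ψ := by
    have h := Finset.sum_le_sum fun i (_ : i ∈ Finset.univ) => hBle i (ψ i)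
    rw [← Finset.mul_sum] at h
    have := mul_le_mul_of_nonneg_left h (by positivity : (0 : ℝ) ≤ 1 / n)
    simp only [hH, hD]
    linarith
  have hH0 (ψ : Fin n → E) : 0 ≤ H ψ := by
    refine mul_nonneg (by positivity) (Finset.sum_nonneg fun i _ => ?_)
    have := hL i
    positivity
  have hDx (w : E) : D (fun _ => w) = fbar w - fbar xstar := by
    simp only [hD, hB, hfbar]
    rw [Finset.sum_sub_distrib, Finset.sum_sub_distrib, ← sum_inner, hgrad0, inner_zero_left]
    ring
  have hTD (z : E) (ψ : Fin n → E) : T z ψ = D ψ + c * ‖z - xstar‖ ^ 2 := by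
    rw [hT]
    simp only [hD, hB, hfbar]
    rw [Finset.sum_sub_distrib, Finset.sum_sub_distrib]
    ring
  -- Lower bounds on the inner product with the full gradient.
  set G : E := (1 / n : ℝ) • ∑ i, g i x with hG
  set P : ℝ := ⟪G, x - xstar⟫ with hP
  have hneg : ⟪G, xstar - x⟫ = -P := by rw [hP, ← inner_neg_right, neg_sub]
  have hP1 : fbar x - fbar xstar + μ / 2 * ‖x - xstar‖ ^ 2 ≤ P := by
    have h := add_fderiv_sub_add_sq_le_of_strongly_convex hsc (hgrad x) xstar
    rw [hneg, norm_sub_rev] at h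
    linarith
  have hP2 : fbar x - fbar xstar + H (fun _ => x) / 2 ≤ P := by
    have h (i : Fin n) : f i x - ⟪g i x, x - xstar⟫ +
        1 / 2 * (1 / Lc i * ‖g i x - g i xstar‖ ^ 2) ≤ f i xstar := by
      have h := (hconv i).add_inner_gradient_add_sq_le (hL i) (hdiff i) (hlip i) x xstar
      have h' : 1 / (2 * Lc i) * ‖g i x - g i xstar‖ ^ 2 =
          1 / 2 * (1 / Lc i * ‖g i x - g i xstar‖ ^ 2) := by
        have := (hL i).ne'
        field_simp
      rw [norm_sub_rev, ← neg_sub x xstar, inner_neg_right] at h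
      simp only [hg] at *
      linarith
    have hs := Finset.sum_le_sum fun i (_ : i ∈ Finset.univ) => h i
    rw [Finset.sum_add_distrib, Finset.sum_sub_distrib, ← Finset.mul_sum] at hs
    have := mul_le_mul_of_nonneg_left hs (by positivity : (0 : ℝ) ≤ 1 / n)
    simp only [hP, hG, hH, hfbar]
    rw [real_inner_smul_left, sum_inner]
    linarith
  -- First and second moments of the gradient estimator.
  have hpa (j : Fin n) : p j * (Lbar / Lc j) = 1 / n := by
    have := (hL j).ne'
    simp only [hp]
    field_simp
  have hmean (w : Fin n → E) : ∑ j, p j • (Lbar / Lc j) • w j = (1 / n : ℝ) • ∑ j, w j := by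
    simp_rw [smul_smul, hpa, Finset.smul_sum]
  have hνmean : ∑ j, p j • ν j = G := by
    simp_rw [hν, smul_add]
    rw [Finset.sum_add_distrib, hmean, ← Finset.sum_smul, hp1, one_smul, ← smul_add,
      Finset.sum_sub_distrib, sub_add_cancel]
  have hmoment (ψ : Fin n → E) :
      ∑ j, p j * ‖(Lbar / Lc j) • (g j (ψ j) - g j xstar)‖ ^ 2 = Lbar * H ψ := by
    simp only [hH]
    rw [← mul_assoc, Finset.mul_sum]
    refine Finset.sum_congr rfl fun j _ => ?_
    have := (hL j).ne'
    rw [norm_smul, mul_pow, Real.norm_eq_abs, sq_abs]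
    simp only [hp]
    field_simp
  have hνsq : ∑ j, p j * ‖ν j‖ ^ 2 ≤ 2 * (Lbar * H fun _ => x) + 2 * (Lbar * H φ) := by
    have h := sum_mul_norm_sub_sub_mean_sq_le p hp0 hp1
      (fun j => (Lbar / Lc j) • (g j x - g j xstar))
      (fun j => (Lbar / Lc j) • (g j (φ j) - g j xstar))
    rw [hmoment φ, hmoment fun _ => x, hmean, Finset.sum_sub_distrib, hgrad0, sub_zero] at h
    refine le_of_eq_of_le (Finset.sum_congr rfl fun j _ => ?_) h
    congr 3
    rw [hν]
    simp only [smul_sub, hg]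
    abel
  have hdist : ∑ j, p j * ‖xplus j - xstar‖ ^ 2 ≤
      ‖x - xstar‖ ^ 2 - 2 * γ * P +
        γ ^ 2 * (2 * (Lbar * H fun _ => x) + 2 * (Lbar * H φ)) := by
    simp_rw [hxplus, sub_right_comm x _ xstar]
    rw [sum_mul_norm_sub_smul_sq p hp1, hνmean]
    linarith [mul_le_mul_of_nonneg_left hνsq (sq_nonneg γ)]
  have hDplus : (1 / n : ℝ) * ∑ r, D (φplus r) =
      (1 - 1 / n) * D φ + 1 / n * (fbar x - fbar xstar) := by
    rw [← hDx]
    simp only [hD, hφplus]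
    rw [← Finset.mul_sum, sum_sum_update, Fintype.card_fin]
    field_simp
  have hLHS : ∑ j, ∑ r, (Lc j / (n * Lbar)) * (1 / n : ℝ) * T (xplus j) (φplus r) =
      (1 / n : ℝ) * ∑ r, D (φplus r) + c * ∑ j, p j * ‖xplus j - xstar‖ ^ 2 := by
    have h (j : Fin n) : ∑ r, (Lc j / (n * Lbar)) * (1 / n : ℝ) * T (xplus j) (φplus r) =
        p j * ((1 / n : ℝ) * ∑ r, D (φplus r)) + c * (p j * ‖xplus j - xstar‖ ^ 2) := by
      simp_rw [hTD]
      rw [← Finset.mul_sum, Finset.sum_add_distrib, Finset.sum_const, Finset.card_univ,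
        Fintype.card_fin, nsmul_eq_mul]
      simp only [hp]
      field_simp
    simp_rw [h]
    rw [Finset.sum_add_distrib, ← Finset.sum_mul, hp1, one_mul,
      Finset.mul_sum _ _ c]
  have hD0 : 0 ≤ D φ := by linarith [hHD φ, hH0 φ]
  rw [hLHS, hDplus, hTD]
  exact saga_contraction_of_moment_bounds hn0 hμ hμL hγ hc hκ (sub_nonneg.2 (hmin x))
    (sq_nonneg _) hD0 (hHD φ) hP1 hP2 hdist
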